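/- arXiv:1710.10730 — 5 statements merged into one kernel-verified Lean document; each statement's English description precedes it below -/
import Mathlib

section
/- For every bounded operator T ∈ B(H) on a quaternionic Hilbert space H, the topological boundary (frontier) of the S-spectrum is contained in the approximate point S-spectrum: ∂σ_S(T) ⊆ Π_S(T). -/
noncomputable section
notation "ℍ" => Quaternion ℝ

variable {H : Type*} [NormedAddCommGroup H] [InnerProductSpace ℝ H] [CompleteSpace H]
  [Module ℍ H] [IsScalarTower ℝ ℍ H] [SMulCommClass ℝ ℍ H] [SMulCommClass ℍ ℝ H]

/-- The pseudo-resolvent second-order operator `𝒬_s(T) = T² − 2(Re s)·T + ‖s‖²·I`. -/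
def QOp (T : H →L[ℍ] H) (s : ℍ) : H →L[ℍ] H :=
  T ∘L T - (2 * s.re) • T + (‖s‖ ^ 2) • (1 : H →L[ℍ] H)

/-- The S-spectrum of `T`. -/
def sSpectrum (T : H →L[ℍ] H) : Set ℍ := {s | ¬ IsUnit (QOp T s)}

/-- The approximate point S-spectrum: `𝒬_s(T)` is not bounded from below. -/
def approxPointSSpectrum (T : H →L[ℍ] H) : Set ℍ :=
  {s | ¬ ∃ K > (0 : ℝ), ∀ v : H, K * ‖v‖ ≤ ‖QOp T s v‖}

/-- An `ℍ`-linear operator is invertible as soon as it is invertible as a real operator. -/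
theorem isUnit_restrictScalars_iff (A : H →L[ℍ] H) :
    IsUnit (A.restrictScalars ℝ) ↔ IsUnit A := by
  constructor
  · rintro ⟨u, hu⟩
    have hl : ∀ x, (u⁻¹).val (A x) = x := fun x => by
      have h : (u⁻¹).val ((u.val) x) = x := congrArg (fun B : H →L[ℝ] H => B x) u.inv_mul
      rwa [hu] at h
    have hr : ∀ x, A ((u⁻¹).val x) = x := fun x => by
      have h : (u.val) ((u⁻¹).val x) = x := congrArg (fun B : H →L[ℝ] H => B x) u.mul_inv
      rwa [hu] at h
    let B : H →L[ℍ] H :=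
      { toFun := (u⁻¹).val
        map_add' := map_add _
        map_smul' := fun q x => by
          rw [RingHom.id_apply, ← hl (q • (u⁻¹).val x), A.map_smul, hr]
        cont := (u⁻¹).val.continuous }
    exact ⟨⟨A, B, ContinuousLinearMap.ext hr, ContinuousLinearMap.ext hl⟩, rfl⟩
  · rintro ⟨u, rfl⟩
    exact ⟨⟨u.val.restrictScalars ℝ, (u⁻¹).val.restrictScalars ℝ,
      ContinuousLinearMap.ext fun x => congrArg (fun B : H →L[ℍ] H => B x) u.mul_inv,
      ContinuousLinearMap.ext fun x => congrArg (fun B : H →L[ℍ] H => B x) u.inv_mul⟩, rfl⟩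

/-- The pseudo-resolvent operator, viewed as a real operator, depends continuously on `s`. -/
theorem continuous_restrictScalars_QOp (T : H →L[ℍ] H) :
    Continuous fun s : ℍ => (QOp T s).restrictScalars ℝ := by
  have h : (fun s : ℍ => (QOp T s).restrictScalars ℝ) = fun s : ℍ =>
      (T.restrictScalars ℝ) ∘L (T.restrictScalars ℝ) - (2 * s.re) • T.restrictScalars ℝ
        + (‖s‖ ^ 2) • (1 : H →L[ℝ] H) := by
    ext s x
    simp [QOp]
  rw [h]
  have hre : Continuous fun s : ℍ => s.re := Quaternion.continuous_re
  fun_prop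

/-- A bounded-below operator in the closure of the invertible operators is invertible. -/
theorem isUnit_of_mem_closure_of_bounded_below {E : Type*} [NormedAddCommGroup E]
    [NormedSpace ℝ E] [CompleteSpace E] {A : E →L[ℝ] E}
    (hA : A ∈ closure {B : E →L[ℝ] E | IsUnit B}) {K : ℝ} (hK : 0 < K)
    (hb : ∀ v, K * ‖v‖ ≤ ‖A v‖) : IsUnit A := by
  obtain ⟨B, ⟨u, rfl⟩, hB⟩ := Metric.mem_closure_iff.1 hA (K / 2) (half_pos hK)
  rw [dist_eq_norm] at hB
  have hinv : ‖(u⁻¹).val‖ ≤ 2 / K := by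
    refine ContinuousLinearMap.opNorm_le_bound _ (by positivity) fun x => ?_
    have hx : u.val ((u⁻¹).val x) = x := congrArg (fun B : E →L[ℝ] E => B x) u.mul_inv
    set y := (u⁻¹).val x
    have h1 : ‖A y‖ ≤ ‖(A - u.val) y‖ + ‖x‖ := by
      calc ‖A y‖ = ‖(A - u.val) y + x‖ := by simp [hx]
        _ ≤ _ := norm_add_le _ _
    have h2 : ‖(A - u.val) y‖ ≤ K / 2 * ‖y‖ :=
      ((A - u.val).le_opNorm y).trans (by gcongr)
    have h3 := hb y
    rw [div_mul_eq_mul_div, le_div_iff₀ hK]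
    linarith
  have hlt : ‖(u⁻¹).val * (u.val - A)‖ < 1 := by
    calc ‖(u⁻¹).val * (u.val - A)‖ ≤ ‖(u⁻¹).val‖ * ‖u.val - A‖ := norm_mul_le _ _
      _ ≤ 2 / K * ‖u.val - A‖ := by gcongr
      _ < 2 / K * (K / 2) := by
        rw [norm_sub_rev]
        gcongr
      _ = 1 := by field_simp
  have hfac : A = u.val * (1 - (u⁻¹).val * (u.val - A)) := by
    rw [mul_sub, Units.mul_inv_cancel_left, mul_one, sub_sub_cancel]
  rw [hfac]
  exact u.isUnit.mul (isUnit_one_sub_of_norm_lt_one hlt)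

/-- The topological boundary of the S-spectrum is contained in the approximate
point S-spectrum. -/
theorem frontier_sSpectrum_subset_approxPointSSpectrum (T : H →L[ℍ] H)
    (hnorm : ∀ (q : ℍ) (x : H), ‖q • x‖ = ‖q‖ * ‖x‖) :
    frontier (sSpectrum T) ⊆ approxPointSSpectrum T := by
  rintro s hs ⟨K, hK, hb⟩
  have hopen : IsOpen (sSpectrum T)ᶜ := by
    have h := Units.isOpen.preimage (continuous_restrictScalars_QOp T)
    convert h using 1
    ext s
    simp [sSpectrum, isUnit_restrictScalars_iff]
  have hmem : s ∈ sSpectrum T := (isOpen_compl_iff.1 hopen).frontier_subset hs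
  rw [frontier_eq_closure_inter_closure] at hs
  refine hmem ((isUnit_restrictScalars_iff _).1
    (isUnit_of_mem_closure_of_bounded_below ?_ hK hb))
  refine map_mem_closure (f := fun s : ℍ => (QOp T s).restrictScalars ℝ)
    (continuous_restrictScalars_QOp T) hs.2 fun t ht => ?_
  exact (isUnit_restrictScalars_iff _).2 (not_not.1 ht)
end
end

section
/- (Gelfand formula for the S-spectral radius.) Let H be a quaternionic Hilbert space and T ∈ B(H). Then the sequence ‖Tⁿ‖^{1/n} converges as n → ∞ and its limit equals the S-spectral radius r_S(T) := sup{‖s‖ : s ∈ σ_S(T)}. -/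
noncomputable section
variable {H : Type*} [NormedAddCommGroup H] [InnerProductSpace ℝ H] [CompleteSpace H]
  [Module ℍ H] [IsScalarTower ℝ ℍ H] [SMulCommClass ℝ ℍ H] [SMulCommClass ℍ ℝ H]

/-- The S-spectral radius `r_S(T) = sup {‖s‖ : s ∈ σ_S(T)}`. -/
def sSpectralRadius (T : H →L[ℍ] H) : ℝ := sSup (norm '' sSpectrum T)

/-- The operator norm of a bounded quaternionic linear operator (computed as the
norm of the underlying bounded real-linear operator; the defining supremum is the
same). -/
def opNormQ (T : H →L[ℍ] H) : ℝ := ‖T.restrictScalars ℝ‖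

open scoped NNReal ENNReal in
/-- Gelfand's formula with the spectral radius written as a real supremum. -/
lemma tendsto_pow_norm_rpow_sSup_norm_spectrum {A : Type*} [NormedRing A] [NormedAlgebra ℂ A]
    [CompleteSpace A] [Nontrivial A] (a : A) :
    Filter.Tendsto (fun n : ℕ => ‖a ^ n‖ ^ (1 / (n : ℝ))) Filter.atTop
      (nhds (sSup (norm '' spectrum ℂ a))) := by
  obtain ⟨k, hk, hka⟩ := spectrum.exists_nnnorm_eq_spectralRadius a
  have hgreatest : IsGreatest (norm '' spectrum ℂ a) ‖k‖ := by
    refine ⟨⟨k, hk, rfl⟩, ?_⟩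
    rintro _ ⟨z, hz, rfl⟩
    have h : (‖z‖₊ : ℝ≥0∞) ≤ ‖k‖₊ := by
      rw [hka]
      exact le_iSup₂ (f := fun w (_ : w ∈ spectrum ℂ a) => (‖w‖₊ : ℝ≥0∞)) z hz
    exact_mod_cast h
  rw [hgreatest.csSup_eq]
  have h := spectrum.pow_norm_pow_one_div_tendsto_nhds_spectralRadius a
  rw [← hka] at h
  have h' := (ENNReal.tendsto_toReal ENNReal.coe_ne_top).comp h
  refine h'.congr fun n => ?_
  exact ENNReal.toReal_ofReal (by positivity)

/-- A quaternionic operator, viewed as complex linear for a complex structure that comes from the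
embedding of `ℂ` into the quaternions. -/
def complexRestrict {E : Type*} [NormedAddCommGroup E] [NormedSpace ℂ E] [Module ℍ E]
    (hcompat : ∀ (z : ℂ) (x : E), z • x = (z : ℍ) • x) :
    (E →L[ℍ] E) →* (E →L[ℂ] E) where
  toFun T :=
    { toFun := T
      map_add' := T.map_add
      map_smul' := fun z x => by simp [hcompat]
      cont := T.continuous }
  map_one' := rfl
  map_mul' _ _ := rfl

lemma isUnit_complexRestrict_iff {E : Type*} [NormedAddCommGroup E] [NormedSpace ℂ E] [Module ℍ E]
    (hcompat : ∀ (z : ℂ) (x : E), z • x = (z : ℍ) • x) (T : E →L[ℍ] E) :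
    IsUnit (complexRestrict hcompat T) ↔ IsUnit T := by
  refine ⟨fun h => ?_, fun h => h.map _⟩
  obtain ⟨S, hTS, hST⟩ := isUnit_iff_exists.mp h
  have hr : ∀ x, T (S x) = x := fun x => DFunLike.congr_fun hTS x
  have hl : ∀ x, S (T x) = x := fun x => DFunLike.congr_fun hST x
  let S' : E →L[ℍ] E :=
    { toFun := S
      map_add' := S.map_add
      map_smul' := fun q x => by
        rw [RingHom.id_apply, ← hl (q • S x), T.map_smul, hr]
      cont := S.continuous }
  exact isUnit_iff_exists.mpr ⟨S', ContinuousLinearMap.ext hr, ContinuousLinearMap.ext hl⟩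

lemma Complex.exists_re_eq_norm_eq {r t : ℝ} (h : |t| ≤ r) :
    ∃ z : ℂ, z.re = t ∧ ‖z‖ = r := by
  refine ⟨⟨t, √(r ^ 2 - t ^ 2)⟩, rfl, ?_⟩
  have hr : 0 ≤ r := (abs_nonneg t).trans h
  have ht : t ^ 2 ≤ r ^ 2 := sq_le_sq.mpr (h.trans (le_abs_self r))
  rw [← sq_eq_sq₀ (norm_nonneg _) hr, Complex.sq_norm, Complex.normSq_mk,
    Real.mul_self_sqrt (sub_nonneg.mpr ht)]
  ring

lemma Quaternion.norm_coeComplex (z : ℂ) : ‖(z : ℍ)‖ = ‖z‖ := by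
  rw [← sq_eq_sq₀ (norm_nonneg _) (norm_nonneg _), sq ‖(z : ℍ)‖,
    ← Quaternion.normSq_eq_norm_mul_self, Quaternion.normSq_def', Complex.sq_norm,
    Complex.normSq_apply]
  simp [sq]

lemma Quaternion.abs_re_le_norm (s : ℍ) : |s.re| ≤ ‖s‖ := by
  refine abs_le_of_sq_le_sq ?_ (norm_nonneg s)
  rw [sq ‖s‖, ← Quaternion.normSq_eq_norm_mul_self, Quaternion.normSq_def']
  nlinarith [sq_nonneg s.imI, sq_nonneg s.imJ, sq_nonneg s.imK]

section ComplexStructure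

variable {E : Type*} [NormedAddCommGroup E] [InnerProductSpace ℝ E]
  [Module ℍ E] [IsScalarTower ℝ ℍ E] [SMulCommClass ℍ ℝ E]
  [NormedSpace ℂ E]

lemma complexRestrict_QOp (hcompat : ∀ (z : ℂ) (x : E), z • x = (z : ℍ) • x) (T : E →L[ℍ] E)
    {s : ℍ} {z : ℂ} (hre : z.re = s.re) (hnorm : ‖z‖ = ‖s‖) :
    complexRestrict hcompat (QOp T s) =
      (algebraMap ℂ (E →L[ℂ] E) z - complexRestrict hcompat T) *
        (algebraMap ℂ (E →L[ℂ] E) (starRingEnd ℂ z) - complexRestrict hcompat T) := by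
  have hreal : ∀ (r : ℝ) (x : E), r • x = (r : ℂ) • x := fun r x => by
    rw [hcompat, ← smul_one_smul ℍ r x]
    congr 1
    rw [Quaternion.coeComplex_coe, ← Algebra.algebraMap_eq_smul_one]
    rfl
  ext x
  change T (T x) - (2 * s.re) • T x + (‖s‖ ^ 2) • x =
    z • ((starRingEnd ℂ z) • x - T x) - T ((starRingEnd ℂ z) • x - T x)
  have hT : T ((starRingEnd ℂ z) • x) = (starRingEnd ℂ z) • T x :=
    (complexRestrict hcompat T).map_smul _ x
  have h1 : ((2 * s.re : ℝ) : ℂ) = z + starRingEnd ℂ z := by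
    rw [Complex.add_conj, hre]
  have h2 : ((‖s‖ ^ 2 : ℝ) : ℂ) = z * starRingEnd ℂ z := by
    rw [Complex.mul_conj', hnorm]
    push_cast
    rfl
  rw [hreal, hreal, h1, h2, map_sub, hT]
  module

lemma mem_sSpectrum_iff (hcompat : ∀ (z : ℂ) (x : E), z • x = (z : ℍ) • x) (T : E →L[ℍ] E)
    {s : ℍ} {z : ℂ} (hre : z.re = s.re) (hnorm : ‖z‖ = ‖s‖) :
    s ∈ sSpectrum T ↔ z ∈ spectrum ℂ (complexRestrict hcompat T) ∨
      starRingEnd ℂ z ∈ spectrum ℂ (complexRestrict hcompat T) := by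
  have hcomm : Commute (algebraMap ℂ (E →L[ℂ] E) z - complexRestrict hcompat T)
      (algebraMap ℂ (E →L[ℂ] E) (starRingEnd ℂ z) - complexRestrict hcompat T) :=
    ((Algebra.commute_algebraMap_left z _).sub_right (Algebra.commute_algebraMap_left z _)).sub_left
      ((Algebra.commute_algebraMap_right _ _).sub_right (Commute.refl _))
  rw [sSpectrum, Set.mem_ofPred_eq, ← isUnit_complexRestrict_iff hcompat,
    complexRestrict_QOp hcompat T hre hnorm, hcomm.isUnit_mul_iff, not_and_or,
    spectrum.mem_iff, spectrum.mem_iff]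

lemma norm_image_sSpectrum (hcompat : ∀ (z : ℂ) (x : E), z • x = (z : ℍ) • x) (T : E →L[ℍ] E) :
    norm '' sSpectrum T = norm '' spectrum ℂ (complexRestrict hcompat T) := by
  ext r
  constructor
  · rintro ⟨s, hs, rfl⟩
    obtain ⟨z, hre, hz⟩ := Complex.exists_re_eq_norm_eq (Quaternion.abs_re_le_norm s)
    rcases (mem_sSpectrum_iff hcompat T hre hz).mp hs with h | h
    · exact ⟨z, h, hz⟩
    · exact ⟨starRingEnd ℂ z, h, by rw [RCLike.norm_conj, hz]⟩
  · rintro ⟨z, hz, rfl⟩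
    have hn : ‖z‖ = ‖(z : ℍ)‖ := (Quaternion.norm_coeComplex z).symm
    exact ⟨z, (mem_sSpectrum_iff hcompat T (Quaternion.re_coeComplex z).symm hn).mpr (.inl hz),
      hn.symm⟩

lemma norm_complexRestrict (hcompat : ∀ (z : ℂ) (x : E), z • x = (z : ℍ) • x) (T : E →L[ℍ] E) :
    ‖complexRestrict hcompat T‖ = opNormQ T :=
  le_antisymm
    (ContinuousLinearMap.opNorm_le_bound _ (norm_nonneg (T.restrictScalars ℝ))
      (T.restrictScalars ℝ).le_opNorm)
    (ContinuousLinearMap.opNorm_le_bound _ (norm_nonneg _) (complexRestrict hcompat T).le_opNorm)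

end ComplexStructure

/-- The complex normed space obtained from a quaternionic one along `ℂ → ℍ`. -/
abbrev complexNormedSpace {E : Type*} [NormedAddCommGroup E] [Module ℍ E]
    (hnorm : ∀ (q : ℍ) (x : E), ‖q • x‖ = ‖q‖ * ‖x‖) : NormedSpace ℂ E where
  toModule := Module.compHom E (Quaternion.ofComplex : ℂ →ₐ[ℝ] ℍ).toRingHom
  norm_smul_le z x := ((hnorm (z : ℍ) x).trans (by rw [Quaternion.norm_coeComplex])).le

/-- Gelfand formula for the S-spectral radius: `‖Tⁿ‖^(1/n)` converges to `r_S(T)`. -/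
theorem tendsto_pow_opNorm_rpow_sSpectralRadius (T : H →L[ℍ] H)
    (hnorm : ∀ (q : ℍ) (x : H), ‖q • x‖ = ‖q‖ * ‖x‖) :
    Filter.Tendsto (fun n : ℕ => opNormQ (T ^ n) ^ (1 / (n : ℝ)))
      Filter.atTop (nhds (sSpectralRadius T)) := by
  let _ : NormedSpace ℂ H := complexNormedSpace hnorm
  have hcompat : ∀ (z : ℂ) (x : H), z • x = (z : ℍ) • x := fun _ _ => rfl
  rcases subsingleton_or_nontrivial H with hH | hH
  · have hspec : sSpectrum T = ∅ :=
      Set.eq_empty_of_forall_notMem fun s hs => hs (isUnit_of_subsingleton _)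
    rw [sSpectralRadius, hspec, Set.image_empty, Real.sSup_empty]
    refine tendsto_const_nhds.congr' ?_
    filter_upwards [Filter.eventually_ne_atTop 0] with n hn
    have hzero : opNormQ (T ^ n) = 0 := by
      rw [opNormQ, ContinuousLinearMap.opNorm_subsingleton]
    rw [hzero, Real.zero_rpow (one_div_ne_zero (Nat.cast_ne_zero.mpr hn))]
  · have h := tendsto_pow_norm_rpow_sSup_norm_spectrum (complexRestrict hcompat T)
    rw [← norm_image_sSpectrum hcompat T] at h
    refine h.congr fun n => ?_
    rw [← map_pow, norm_complexRestrict hcompat]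
end
end

section
/- For all quaternions q, s ∈ ℍ with q ∉ [s], the following identity holds in ℍ: (q² − 2(Re s)q + ‖s‖²)⁻¹ · (q − s̄) = −(s − q̄) · (s² − 2(Re q)s + ‖q‖²)⁻¹. (Both quaternions q² − 2(Re s)q + ‖s‖² and s² − 2(Re q)s + ‖q‖² are nonzero under this hypothesis.) -/
noncomputable section
/-- The 2-sphere `[s]` of a quaternion `s`. -/
def sphereOf (s : ℍ) : Set ℍ := {p | p.re = s.re ∧ ‖p‖ = ‖s‖}

theorem norm_sq_eq_sum_sq (q : ℍ) :
    ‖q‖ ^ 2 = q.re ^ 2 + q.imI ^ 2 + q.imJ ^ 2 + q.imK ^ 2 := by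
  rw [← Quaternion.normSq_def', Quaternion.normSq_eq_norm_mul_self, sq]

theorem mem_sphereOf_comm {q s : ℍ} : q ∈ sphereOf s ↔ s ∈ sphereOf q := by
  simp only [sphereOf, Set.mem_ofPred_eq, eq_comm]

/-- A root of the characteristic polynomial of `s` lies on the sphere of `s`. -/
theorem mem_sphereOf_of_eq_zero {q s : ℍ}
    (h : q ^ 2 - 2 * (s.re : ℍ) * q + ((‖s‖ ^ 2 : ℝ) : ℍ) = 0) : q ∈ sphereOf s := by
  have two_eq : (2 : ℍ) = ((2 : ℝ) : ℍ) := by norm_cast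
  rw [norm_sq_eq_sum_sq, two_eq, sq q, Quaternion.ext_iff] at h
  simp only [Quaternion.re_add, Quaternion.imI_add, Quaternion.imJ_add, Quaternion.imK_add,
    Quaternion.re_sub, Quaternion.imI_sub, Quaternion.imJ_sub, Quaternion.imK_sub,
    Quaternion.re_mul, Quaternion.imI_mul, Quaternion.imJ_mul, Quaternion.imK_mul,
    Quaternion.re_coe, Quaternion.imI_coe, Quaternion.imJ_coe, Quaternion.imK_coe,
    Quaternion.re_zero, Quaternion.imI_zero, Quaternion.imJ_zero, Quaternion.imK_zero] at h
  obtain ⟨h0, h1, h2, h3⟩ := h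
  have hre : q.re = s.re := by
    by_contra hne
    have hsub : q.re - s.re ≠ 0 := sub_ne_zero.mpr hne
    have hi : q.imI = 0 :=
      (mul_eq_zero.mp (by linarith : (q.re - s.re) * q.imI = 0)).resolve_left hsub
    have hj : q.imJ = 0 :=
      (mul_eq_zero.mp (by linarith : (q.re - s.re) * q.imJ = 0)).resolve_left hsub
    have hk : q.imK = 0 :=
      (mul_eq_zero.mp (by linarith : (q.re - s.re) * q.imK = 0)).resolve_left hsub
    rw [hi, hj, hk] at h0
    nlinarith [sq_pos_of_ne_zero hsub, sq_nonneg s.imI, sq_nonneg s.imJ, sq_nonneg s.imK]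
  refine ⟨hre, (sq_eq_sq₀ (norm_nonneg q) (norm_nonneg s)).mp ?_⟩
  rw [norm_sq_eq_sum_sq, norm_sq_eq_sum_sq]
  rw [hre] at h0 ⊢
  linarith

theorem sub_star_mul_eq_neg_mul_sub_star (q s : ℍ) :
    (q - star s) * (s ^ 2 - 2 * (q.re : ℍ) * s + ((‖q‖ ^ 2 : ℝ) : ℍ)) =
      -((q ^ 2 - 2 * (s.re : ℍ) * q + ((‖s‖ ^ 2 : ℝ) : ℍ)) * (s - star q)) := by
  have two_eq : (2 : ℍ) = ((2 : ℝ) : ℍ) := by norm_cast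
  rw [norm_sq_eq_sum_sq, norm_sq_eq_sum_sq, two_eq, sq q, sq s]
  ext <;>
  simp only [Quaternion.re_add, Quaternion.imI_add, Quaternion.imJ_add, Quaternion.imK_add,
    Quaternion.re_sub, Quaternion.imI_sub, Quaternion.imJ_sub, Quaternion.imK_sub,
    Quaternion.re_mul, Quaternion.imI_mul, Quaternion.imJ_mul, Quaternion.imK_mul,
    Quaternion.re_coe, Quaternion.imI_coe, Quaternion.imJ_coe, Quaternion.imK_coe,
    Quaternion.re_neg, Quaternion.imI_neg, Quaternion.imJ_neg, Quaternion.imK_neg,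
    Quaternion.re_star, Quaternion.imI_star, Quaternion.imJ_star, Quaternion.imK_star] <;>
  ring

/-- The quaternionic identity
`(q² − 2(Re s)q + ‖s‖²)⁻¹ (q − s̄) = −(s − q̄)(s² − 2(Re q)s + ‖q‖²)⁻¹` for `q ∉ [s]`. -/
theorem inv_mul_eq_neg_mul_inv (q s : ℍ) (h : q ∉ sphereOf s) :
    (q ^ 2 - 2 * (s.re : ℍ) * q + ((‖s‖ ^ 2 : ℝ) : ℍ))⁻¹ * (q - star s) =
      -((s - star q) * (s ^ 2 - 2 * (q.re : ℍ) * s + ((‖q‖ ^ 2 : ℝ) : ℍ))⁻¹) := by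
  have hA := mt mem_sphereOf_of_eq_zero h
  have hB := mt mem_sphereOf_of_eq_zero (mt mem_sphereOf_comm.mpr h)
  rw [inv_mul_eq_iff_eq_mul₀ hA, ← neg_mul, ← mul_assoc, eq_mul_inv_iff_mul_eq₀ hB, mul_neg]
  exact sub_star_mul_eq_neg_mul_sub_star q s
end
end

section
/- For all quaternions q, s ∈ ℍ with q ∉ [s], the following identity holds in ℍ: (q − s̄) · (q² − 2(Re s)q + ‖s‖²)⁻¹ = −(s² − 2(Re q)s + ‖q‖²)⁻¹ · (s − q̄). (Both quaternions q² − 2(Re s)q + ‖s‖² and s² − 2(Re q)s + ‖q‖² are nonzero under this hypothesis.) -/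
noncomputable section
theorem quadratic_ne_zero {q s : ℍ} (h : q ∉ sphereOf s) :
    q ^ 2 - 2 * (s.re : ℍ) * q + ((‖s‖ ^ 2 : ℝ) : ℍ) ≠ 0 := by
  intro h0
  rw [norm_sq_eq_sum_sq, two_mul, ← Quaternion.coe_add, Quaternion.coe_mul_eq_smul,
    Quaternion.ext_iff] at h0
  simp only [sq q, Quaternion.re_add, Quaternion.re_sub, Quaternion.re_mul, Quaternion.re_smul,
    Quaternion.re_coe, Quaternion.imI_add, Quaternion.imI_sub, Quaternion.imI_mul,
    Quaternion.imI_smul, Quaternion.imI_coe, Quaternion.imJ_add, Quaternion.imJ_sub,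
    Quaternion.imJ_mul, Quaternion.imJ_smul, Quaternion.imJ_coe, Quaternion.imK_add,
    Quaternion.imK_sub, Quaternion.imK_mul, Quaternion.imK_smul, Quaternion.imK_coe,
    Quaternion.re_zero, Quaternion.imI_zero, Quaternion.imJ_zero, Quaternion.imK_zero,
    smul_eq_mul] at h0
  obtain ⟨hr, hi, hj, hk⟩ := h0
  have hre : q.re = s.re := by
    by_contra hne
    have hne' : q.re - s.re ≠ 0 := sub_ne_zero.mpr hne
    have hi' : q.imI = 0 :=
      (mul_eq_zero.mp (by linarith : (q.re - s.re) * q.imI = 0)).resolve_left hne'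
    have hj' : q.imJ = 0 :=
      (mul_eq_zero.mp (by linarith : (q.re - s.re) * q.imJ = 0)).resolve_left hne'
    have hk' : q.imK = 0 :=
      (mul_eq_zero.mp (by linarith : (q.re - s.re) * q.imK = 0)).resolve_left hne'
    rw [hi', hj', hk'] at hr
    have hpos : 0 < (q.re - s.re) ^ 2 := by positivity
    nlinarith [sq_nonneg s.imI, sq_nonneg s.imJ, sq_nonneg s.imK]
  refine h ⟨hre, (sq_eq_sq₀ (norm_nonneg q) (norm_nonneg s)).mp ?_⟩
  rw [norm_sq_eq_sum_sq, norm_sq_eq_sum_sq]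
  rw [hre] at hr ⊢
  linarith

theorem quadratic_mul_sub_star (q s : ℍ) :
    (s ^ 2 - 2 * (q.re : ℍ) * s + ((‖q‖ ^ 2 : ℝ) : ℍ)) * (q - star s) =
      -((s - star q) * (q ^ 2 - 2 * (s.re : ℍ) * q + ((‖s‖ ^ 2 : ℝ) : ℍ))) := by
  rw [norm_sq_eq_sum_sq, norm_sq_eq_sum_sq, two_mul, two_mul, ← Quaternion.coe_add,
    ← Quaternion.coe_add, Quaternion.coe_mul_eq_smul, Quaternion.coe_mul_eq_smul]
  ext <;>
  · simp only [sq q, sq s, Quaternion.re_add, Quaternion.re_sub, Quaternion.re_mul,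
      Quaternion.re_smul, Quaternion.re_coe, Quaternion.imI_add, Quaternion.imI_sub,
      Quaternion.imI_mul, Quaternion.imI_smul, Quaternion.imI_coe, Quaternion.imJ_add,
      Quaternion.imJ_sub, Quaternion.imJ_mul, Quaternion.imJ_smul, Quaternion.imJ_coe,
      Quaternion.imK_add, Quaternion.imK_sub, Quaternion.imK_mul, Quaternion.imK_smul,
      Quaternion.imK_coe, Quaternion.re_neg, Quaternion.imI_neg, Quaternion.imJ_neg,
      Quaternion.imK_neg, Quaternion.re_star, Quaternion.imI_star, Quaternion.imJ_star,
      Quaternion.imK_star, smul_eq_mul]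
    ring

/-- The quaternionic identity
`(q − s̄)(q² − 2(Re s)q + ‖s‖²)⁻¹ = −(s² − 2(Re q)s + ‖q‖²)⁻¹ (s − q̄)` for `q ∉ [s]`. -/
theorem mul_inv_eq_neg_inv_mul (q s : ℍ) (h : q ∉ sphereOf s) :
    (q - star s) * (q ^ 2 - 2 * (s.re : ℍ) * q + ((‖s‖ ^ 2 : ℝ) : ℍ))⁻¹ =
      -((s ^ 2 - 2 * (q.re : ℍ) * s + ((‖q‖ ^ 2 : ℝ) : ℍ))⁻¹ * (s - star q)) := by
  have hq := quadratic_ne_zero h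
  have hs := quadratic_ne_zero (q := s) (s := q) fun h' => h ⟨h'.1.symm, h'.2.symm⟩
  rw [mul_inv_eq_iff_eq_mul₀ hq, neg_mul, mul_assoc, ← mul_neg, eq_inv_mul_iff_mul_eq₀ hs]
  exact quadratic_mul_sub_star q s
end
end

section
/- For all quaternions w, s ∈ ℍ one has ‖w² − 2(Re s)w + ‖s‖²‖ ≥ d², where d := inf{‖w − p‖ : p ∈ [s]} is the distance from w to the 2-sphere [s] (Metric.infDist w [s]). -/
noncomputable section
theorem star_mem_sphereOf {p s : ℍ} (hp : p ∈ sphereOf s) : star p ∈ sphereOf s :=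
  ⟨by rw [Quaternion.re_star, hp.1], by rw [norm_star, hp.2]⟩

theorem exists_mem_sphereOf_commute (w s : ℍ) : ∃ p ∈ sphereOf s, Commute w p := by
  by_cases hw : w.im = 0
  · refine ⟨s, ⟨rfl, rfl⟩, ?_⟩
    rw [← Quaternion.re_add_im w, hw, add_zero]
    exact Quaternion.coe_commutes _ _
  · have hw' : ‖w.im‖ ≠ 0 := norm_ne_zero_iff.mpr hw
    have norm_sq (q : ℍ) : ‖q‖ ^ 2 = q.re ^ 2 + ‖q.im‖ ^ 2 := by
      simp only [sq, ← Quaternion.normSq_eq_norm_mul_self, Quaternion.normSq_def',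
        Quaternion.re_im, Quaternion.imI_im, Quaternion.imJ_im, Quaternion.imK_im]
      ring
    refine ⟨(s.re : ℍ) + (‖s.im‖ / ‖w.im‖) • w.im, ⟨by simp, ?_⟩, ?_⟩
    · rw [← sq_eq_sq₀ (norm_nonneg _) (norm_nonneg _), norm_sq, norm_sq s]
      simp [norm_smul, hw']
    · refine (Quaternion.coe_commute _ _).symm.add_right (Commute.smul_right ?_ _)
      conv_lhs => rw [← Quaternion.re_add_im w]
      exact (Quaternion.coe_commute _ _).add_left (Commute.refl _)

theorem quadratic_eq_mul_of_commute {w p s : ℍ} (hp : p ∈ sphereOf s) (h : Commute w p) :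
    w ^ 2 - 2 * (s.re : ℍ) * w + ((‖s‖ ^ 2 : ℝ) : ℍ) = (w - p) * (w - star p) := by
  have hsum : 2 * (s.re : ℍ) = p + star p := by
    rw [Quaternion.self_add_star, hp.1]
  have hmul : ((‖s‖ ^ 2 : ℝ) : ℍ) = p * star p := by
    rw [Quaternion.self_mul_star, Quaternion.normSq_eq_norm_mul_self, hp.2, sq]
  have hstar : w * star p = star p * w := by
    have h2 : w * (p + star p) = (p + star p) * w := by
      rw [Quaternion.self_add_star', Quaternion.coe_commutes]
    rw [mul_add, add_mul, h.eq] at h2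
    exact add_left_cancel h2
  rw [hsum, hmul, sub_mul, mul_sub, mul_sub, hstar]
  noncomm_ring

/-- The norm of `w² − 2(Re s)w + ‖s‖²` is at least the square of the distance
from `w` to the sphere `[s]`. -/
theorem sq_infDist_le_norm_quadratic (w s : ℍ) :
    (Metric.infDist w (sphereOf s)) ^ 2 ≤
      ‖w ^ 2 - 2 * (s.re : ℍ) * w + ((‖s‖ ^ 2 : ℝ) : ℍ)‖ := by
  obtain ⟨p, hp, hc⟩ := exists_mem_sphereOf_commute w s
  rw [quadratic_eq_mul_of_commute hp hc, norm_mul, sq, ← dist_eq_norm, ← dist_eq_norm]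
  exact mul_le_mul (Metric.infDist_le_dist_of_mem hp)
    (Metric.infDist_le_dist_of_mem (star_mem_sphereOf hp)) Metric.infDist_nonneg dist_nonneg
end
end
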